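/- arXiv:1307.8247 — 2 statements merged into one kernel-verified Lean document; each statement's English description precedes it below -/
import Mathlib

section
/- Assume Q satisfies condition (C). The map sending a nonempty poset-ideal I of J(Q) to the function x ↦ min{r + l_Q(a,x) : (r,a) ∈ I} is a well-defined order isomorphism from the set of nonempty poset-ideals of J(Q), ordered by inclusion, onto the poset L*(Q). -/
/-!
Setup: a quiver is given by a vertex type `V`, an arrow type `E`, and source/target maps
`src tgt : E → V`.  `DCost src tgt x y n` says that there is a path from `x` to `y` in the
double quiver `Q̃` using exactly `n` forward arrows, and `lQ src tgt x y` is the minimal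
such `n` (this is `l_Q(x, y)`; it is well defined when the quiver is connected).
-/

/-- `DCost src tgt x y n`: there is a path from `x` to `y` in the double quiver with
exactly `n` forward arrows. -/
inductive DCost {V E : Type*} (src tgt : E → V) : V → V → ℕ → Prop
  | refl (x : V) : DCost src tgt x x 0
  | fwd {x : V} {n : ℕ} (e : E) : DCost src tgt x (src e) n → DCost src tgt x (tgt e) (n + 1)
  | bwd {x : V} {n : ℕ} (e : E) : DCost src tgt x (tgt e) n → DCost src tgt x (src e) n

/-- `l_Q(x, y)`: the minimal number of forward arrows on a path from `x` to `y` in the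
double quiver. -/
noncomputable def lQ {V E : Type*} (src tgt : E → V) (x y : V) : ℕ :=
  sInf {n : ℕ | DCost src tgt x y n}

/-- The quiver is connected (its double quiver joins any two vertices by a path). -/
def QConnected {V E : Type*} (src tgt : E → V) : Prop :=
  ∀ x y : V, ∃ n : ℕ, DCost src tgt x y n

/-- The quiver has no loops. -/
def NoLoops {V E : Type*} (src tgt : E → V) : Prop := ∀ e : E, src e ≠ tgt e

/-- The quiver has no oriented cycles. -/
def NoOrientedCycles {V E : Type*} (src tgt : E → V) : Prop :=
  ∀ x : V, ¬ Relation.TransGen (fun a b : V => ∃ e : E, src e = a ∧ tgt e = b) x x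

/-- Condition (C): every vertex is incident to at least two arrows. -/
def CondC {V E : Type*} (src tgt : E → V) : Prop :=
  ∀ a : V, 2 ≤ Nat.card {e : E // src e = a ∨ tgt e = a}

/-- `L*(Q)`: the set of functions `z : Q₀ → ℕ` with `z a ≤ z b + l_Q(b, a)` for all
`a, b ∈ Q₀`, ordered by `z ≤ z'` iff `z a ≥ z' a` for all `a` (opposite pointwise order). -/
def LstarSet {V E : Type*} (src tgt : E → V) : Set (V → ℕ) :=
  {z | ∀ a b : V, z a ≤ z b + lQ src tgt b a}

/-- The partial order on `J(Q) = ℕ × Q₀`: `(r, a) ≤ (s, b)` iff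
`l_Q(a, x) + r ≥ l_Q(b, x) + s` for all `x ∈ Q₀`. -/
def Jle {V E : Type*} (src tgt : E → V) (p q : ℕ × V) : Prop :=
  ∀ x : V, lQ src tgt q.2 x + q.1 ≤ lQ src tgt p.2 x + p.1

/-- A poset-ideal of `J(Q)`. -/
def JIdeal {V E : Type*} (src tgt : E → V) (I : Set (ℕ × V)) : Prop :=
  ∀ p q : ℕ × V, Jle src tgt p q → q ∈ I → p ∈ I

/-- The map sending an ideal `I` of `J(Q)` to the function
`x ↦ min {r + l_Q(a, x) : (r, a) ∈ I}`. -/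
noncomputable def rhoFn {V E : Type*} (src tgt : E → V) (I : Set (ℕ × V)) : V → ℕ :=
  fun x => sInf {n : ℕ | ∃ p ∈ I, n = p.1 + lQ src tgt p.2 x}

theorem DCost.trans {V E : Type*} {src tgt : E → V} {x y z : V} {m n : ℕ}
    (h : DCost src tgt x y m) (h' : DCost src tgt y z n) : DCost src tgt x z (m + n) := by
  induction h' with
  | refl => exact h
  | fwd e _ ih => exact .fwd e ih
  | bwd e _ ih => exact .bwd e ih

theorem lQ_self {V E : Type*} (src tgt : E → V) (x : V) : lQ src tgt x x = 0 :=
  Nat.le_zero.mp (Nat.sInf_le (DCost.refl x))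

theorem QConnected.lQ_triangle {V E : Type*} {src tgt : E → V} (h : QConnected src tgt)
    (x y z : V) : lQ src tgt x z ≤ lQ src tgt x y + lQ src tgt y z :=
  Nat.sInf_le ((Nat.sInf_mem (h x y)).trans (Nat.sInf_mem (h y z)))

theorem rhoFn_le {V E : Type*} (src tgt : E → V) {I : Set (ℕ × V)} {p : ℕ × V} (hp : p ∈ I)
    (x : V) : rhoFn src tgt I x ≤ p.1 + lQ src tgt p.2 x :=
  Nat.sInf_le ⟨p, hp, rfl⟩

theorem exists_rhoFn_eq {V E : Type*} (src tgt : E → V) {I : Set (ℕ × V)} (hI : I.Nonempty)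
    (x : V) : ∃ p ∈ I, rhoFn src tgt I x = p.1 + lQ src tgt p.2 x :=
  Nat.sInf_mem (s := {n : ℕ | ∃ p ∈ I, n = p.1 + lQ src tgt p.2 x})
    (hI.elim fun p hp => ⟨_, p, hp, rfl⟩)

/-- Assume `Q` satisfies condition (C).  The map sending a nonempty
poset-ideal `I` of `J(Q)` to the function `x ↦ min {r + l_Q(a, x) : (r, a) ∈ I}` is a
well-defined order isomorphism from the set of nonempty poset-ideals of `J(Q)`, ordered
by inclusion, onto the poset `L*(Q)` (ordered by `z ≤ z'` iff `z a ≥ z' a` pointwise). -/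
theorem stmt4 {V E : Type*} [Fintype V] [Fintype E] [Nonempty V] (src tgt : E → V)
    (hconn : QConnected src tgt) (hloops : NoLoops src tgt)
    (hacyc : NoOrientedCycles src tgt) (hC : CondC src tgt) :
    (∀ I : Set (ℕ × V), JIdeal src tgt I → I.Nonempty →
      rhoFn src tgt I ∈ LstarSet src tgt) ∧
    (∀ I I' : Set (ℕ × V), JIdeal src tgt I → I.Nonempty → JIdeal src tgt I' →
      I'.Nonempty → (I ⊆ I' ↔ ∀ x : V, rhoFn src tgt I' x ≤ rhoFn src tgt I x)) ∧
    (∀ z ∈ LstarSet src tgt, ∃ I : Set (ℕ × V),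
      JIdeal src tgt I ∧ I.Nonempty ∧ rhoFn src tgt I = z) := by
  refine ⟨fun I _ hne a b => ?_, fun I I' _ hne hI' hne' => ⟨fun hsub x => ?_, ?_⟩,
    fun z hz => ⟨{p | z p.2 ≤ p.1}, fun p q hpq hq => ?_, ?_, ?_⟩⟩
  · obtain ⟨p, hp, hb⟩ := exists_rhoFn_eq src tgt hne b
    have := rhoFn_le src tgt hp a
    have := hconn.lQ_triangle p.2 b a
    omega
  · obtain ⟨p, hp, hx⟩ := exists_rhoFn_eq src tgt hne x
    exact hx ▸ rhoFn_le src tgt (hsub hp) x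
  · intro hle p hp
    obtain ⟨q, hq, hqp⟩ := exists_rhoFn_eq src tgt hne' p.2
    refine hI' p q (fun x => ?_) hq
    have := hle p.2
    have := rhoFn_le src tgt hp p.2
    have := lQ_self src tgt p.2
    have := hconn.lQ_triangle q.2 p.2 x
    omega
  · have h₁ : z q.2 ≤ q.1 := hq
    have h₂ := hpq p.2
    have h₃ := hz p.2 q.2
    rw [lQ_self] at h₂
    change z p.2 ≤ p.1
    omega
  · obtain ⟨v⟩ := ‹Nonempty V›
    exact ⟨(z v, v), le_refl (z v)⟩
  · funext x
    have hx : (z x, x) ∈ {p : ℕ × V | z p.2 ≤ p.1} := le_refl (z x)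
    refine le_antisymm ?_ ?_
    · simpa [lQ_self] using rhoFn_le src tgt hx x
    · obtain ⟨p, hp, hpx⟩ := exists_rhoFn_eq src tgt ⟨_, hx⟩ x
      have h₁ : z p.2 ≤ p.1 := hp
      have h₂ := hz x p.2
      omega
end

section
/- If (L,τ⁻¹) satisfies conditions (c0)–(c4), then for all x, y ∈ L and every λ ∈ Λ, φ(x ∨ y)_λ = min{φ(x)_λ, φ(y)_λ} and φ(x ∧ y)_λ = max{φ(x)_λ, φ(y)_λ}. -/
/-!
Setup: an infinite distributive lattice `L` with maximum element (`⊤`) and a map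
`t = τ⁻¹ : L → L` which is injective, preserves binary joins and meets, reflects
and preserves the order, and maps covering pairs to covering pairs.

A covering pair is encoded as `p : L × L` with `p.2 ⋖ p.1` (i.e. `p.1` covers `p.2`,
written `p.1 ⋗ p.2` in the paper).
-/

/-- The generating relation for the equivalence `∼` on covering pairs:
(a) `(x ⋗ y) ∼ (τ⁻¹x ⋗ τ⁻¹y)`; (b) `(x ⋗ y) ∼ (x' ⋗ y')` whenever `x ⋗ x'` and `y ⋗ y'`. -/
def CPGen {L : Type*} [PartialOrder L] (t : L → L) (p q : L × L) : Prop :=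
  (p.2 ⋖ p.1 ∧ q = (t p.1, t p.2)) ∨
  (p.2 ⋖ p.1 ∧ q.2 ⋖ q.1 ∧ q.1 ⋖ p.1 ∧ q.2 ⋖ p.2)

/-- The equivalence relation `∼` on covering pairs: the smallest equivalence relation
containing the generating relation `CPGen`. -/
def CPeq {L : Type*} [PartialOrder L] (t : L → L) : L × L → L × L → Prop :=
  Relation.EqvGen (CPGen t)

/-- `t = τ⁻¹` is injective, preserves binary joins and meets, reflects and preserves
the order, and maps covering pairs to covering pairs. -/
structure TauMap {L : Type*} [Lattice L] (t : L → L) : Prop where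
  inj : Function.Injective t
  map_sup : ∀ x y : L, t (x ⊔ y) = t x ⊔ t y
  map_inf : ∀ x y : L, t (x ⊓ y) = t x ⊓ t y
  le_iff : ∀ x y : L, x ≤ y ↔ t x ≤ t y
  cov : ∀ x y : L, x ⋖ y → t x ⋖ t y

/-- `P := L ∖ τ⁻¹(L)`. -/
def TauP {L : Type*} (t : L → L) : Set L := {x | x ∉ Set.range t}

/-- `w 0 ⋗ w 1 ⋗ ⋯ ⋗ w r` is a covering chain. -/
def IsCovChain {L : Type*} [PartialOrder L] (w : ℕ → L) (r : ℕ) : Prop :=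
  ∀ i < r, w (i + 1) ⋖ w i

/-- (c0): `P` is nonempty and finite. -/
def CondC0 {L : Type*} (t : L → L) : Prop := (TauP t).Nonempty ∧ (TauP t).Finite

/-- (c1): every element of `L` equals `τ^{-r} p` for a unique pair `(r, p) ∈ ℕ × P`. -/
def CondC1 {L : Type*} (t : L → L) : Prop :=
  ∀ x : L, ∃! rp : ℕ × L, rp.2 ∈ TauP t ∧ t^[rp.1] rp.2 = x

/-- (c2): for all `x, y ∈ P` and `r > 0`, `x < τ^{-r} y` fails. -/
def CondC2 {L : Type*} [PartialOrder L] (t : L → L) : Prop :=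
  ∀ x ∈ TauP t, ∀ y ∈ TauP t, ∀ r : ℕ, 0 < r → ¬ x < t^[r] y

/-- (c3): `x ⋗ y` implies `y ≥ τ⁻¹ x`. -/
def CondC3 {L : Type*} [PartialOrder L] (t : L → L) : Prop :=
  ∀ x y : L, y ⋖ x → t x ≤ y

/-- (c4): for every `x ∈ P` there is a covering chain from `x` to `τ⁻¹x` whose covering
pairs lie in pairwise distinct `∼`-classes forming a complete set of representatives of `Λ`. -/
def CondC4 {L : Type*} [PartialOrder L] (t : L → L) : Prop :=
  ∀ x ∈ TauP t, ∃ (r : ℕ) (w : ℕ → L), w 0 = x ∧ w r = t x ∧ IsCovChain w r ∧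
    (∀ i < r, ∀ j < r, i ≠ j → ¬ CPeq t (w i, w (i + 1)) (w j, w (j + 1))) ∧
    (∀ p : L × L, p.2 ⋖ p.1 → ∃ i < r, CPeq t (w i, w (i + 1)) p)

/-- `φ(w, λ)` for a covering chain `w` of length `r`, with the class `λ` represented by a
covering pair `p`: the number of indices whose covering pair is `∼`-equivalent to `p`. -/
noncomputable def chainCnt {L : Type*} [PartialOrder L] (t : L → L) (w : ℕ → L) (r : ℕ) (p : L × L) : ℕ :=
  Set.ncard {i : ℕ | i < r ∧ CPeq t (w i, w (i + 1)) p}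

open scoped Classical in
/-- `φ(x)_λ` (`λ` represented by the covering pair `p`), computed from a covering chain
from the maximum element `⊤` to `x`. -/
noncomputable def phi {L : Type*} [PartialOrder L] [OrderTop L] (t : L → L) (x : L)
    (p : L × L) : ℕ :=
  if h : ∃ (w : ℕ → L) (r : ℕ), w 0 = ⊤ ∧ w r = x ∧ IsCovChain w r then
    chainCnt t h.choose h.choose_spec.choose p
  else 0

theorem CPeq.congr_left {L : Type*} [PartialOrder L] {t : L → L} {q q' p : L × L}
    (h : CPeq t q q') : CPeq t q p ↔ CPeq t q' p :=
  ⟨fun h' => .trans _ _ _ (.symm _ _ h) h', fun h' => .trans _ _ _ h h'⟩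

open scoped Classical in
/-- The contribution of the covering pair `q` to the count of the class of `p`. -/
noncomputable def pairWeight {L : Type*} [PartialOrder L] (t : L → L) (p q : L × L) : ℕ :=
  if CPeq t q p then 1 else 0

theorem pairWeight_congr {L : Type*} [PartialOrder L] {t : L → L} {q q' p : L × L}
    (h : CPeq t q q') : pairWeight t p q = pairWeight t p q' := by
  classical
  unfold pairWeight
  simp only [h.congr_left]

theorem pairWeight_eq_one {L : Type*} [PartialOrder L] {t : L → L} {q p : L × L}
    (h : CPeq t q p) : pairWeight t p q = 1 := if_pos h

theorem pairWeight_eq_zero {L : Type*} [PartialOrder L] {t : L → L} {q p : L × L}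
    (h : ¬ CPeq t q p) : pairWeight t p q = 0 := if_neg h

/-- `ChainCount t p x z n`: some covering chain from `x` down to `z` contains exactly `n`
covering pairs equivalent to `p`. -/
inductive ChainCount {L : Type*} [PartialOrder L] (t : L → L) (p : L × L) : L → L → ℕ → Prop
  | refl (x : L) : ChainCount t p x x 0
  | step {x y z : L} {n : ℕ} (h : y ⋖ x) (c : ChainCount t p y z n) :
      ChainCount t p x z (pairWeight t p (x, y) + n)

namespace ChainCount

section PartialOrder

variable {L : Type*} [PartialOrder L] {t : L → L} {p : L × L} {x y z : L} {n m : ℕ}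

theorem le (h : ChainCount t p x z n) : z ≤ x := by
  induction h with
  | refl => exact le_rfl
  | step h _ ih => exact ih.trans h.le

theorem single (h : y ⋖ x) : ChainCount t p x y (pairWeight t p (x, y)) :=
  .step h (.refl y)

theorem append (h : ChainCount t p x y n) (h' : ChainCount t p y z m) :
    ChainCount t p x z (n + m) := by
  induction h with
  | refl => simpa using h'
  | step hc _ ih => simpa [add_assoc] using ChainCount.step hc (ih h')

theorem map (hcov : ∀ x y : L, x ⋖ y → t x ⋖ t y) (h : ChainCount t p x y n) :
    ChainCount t p (t x) (t y) n := by
  induction h with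
  | refl => exact .refl _
  | step hc _ ih =>
    rw [pairWeight_congr (.rel _ _ (.inl ⟨hc, rfl⟩))]
    exact .step (hcov _ _ hc) ih

theorem map_iterate (hcov : ∀ x y : L, x ⋖ y → t x ⋖ t y) (h : ChainCount t p x y n) (r : ℕ) :
    ChainCount t p (t^[r] x) (t^[r] y) n := by
  induction r with
  | zero => exact h
  | succ r ih => simpa only [Function.iterate_succ_apply'] using ih.map hcov

theorem exists_of_le [LocallyFiniteOrder L] (h : z ≤ x) : ∃ n, ChainCount t p x z n := by
  induction le_iff_reflTransGen_covBy.1 h with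
  | refl => exact ⟨0, .refl _⟩
  | tail h₁ hc ih =>
    obtain ⟨n, hn⟩ := ih (le_iff_reflTransGen_covBy.2 h₁)
    exact ⟨_, .step hc hn⟩

theorem exists_isCovChain (h : ChainCount t p x z n) :
    ∃ (w : ℕ → L) (r : ℕ), w 0 = x ∧ w r = z ∧ IsCovChain w r := by
  induction h with
  | refl x => exact ⟨fun _ => x, 0, rfl, rfl, fun _ h => absurd h (Nat.not_lt_zero _)⟩
  | @step x y z n hc _ ih =>
    obtain ⟨w, r, h0, hr, hw⟩ := ih
    refine ⟨fun i => Nat.casesOn i x w, r + 1, rfl, hr, fun i hi => ?_⟩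
    cases i with
    | zero => simpa [h0] using hc
    | succ i => exact hw i (by omega)

end PartialOrder

end ChainCount

theorem chainCnt_succ {L : Type*} [PartialOrder L] (t : L → L) (w : ℕ → L) (r : ℕ)
    (p : L × L) :
    chainCnt t w (r + 1) p = chainCnt t w r p + pairWeight t p (w r, w (r + 1)) := by
  classical
  have key : ∀ k, chainCnt t w k p =
      ∑ i ∈ Finset.range k, pairWeight t p (w i, w (i + 1)) := by
    intro k
    have : {i : ℕ | i < k ∧ CPeq t (w i, w (i + 1)) p} =
        ((Finset.range k).filter fun i => CPeq t (w i, w (i + 1)) p : Finset ℕ) := by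
      ext i; simp
    rw [chainCnt, this, Set.ncard_coe_finset, Finset.card_filter]
    exact Finset.sum_congr rfl fun i _ => by unfold pairWeight; congr
  rw [key, key, Finset.sum_range_succ]

theorem IsCovChain.chainCount {L : Type*} [PartialOrder L] {t : L → L} {w : ℕ → L} {r : ℕ}
    (h : IsCovChain w r) (p : L × L) : ChainCount t p (w 0) (w r) (chainCnt t w r p) := by
  induction r with
  | zero =>
    have : chainCnt t w 0 p = 0 := by simp [chainCnt]
    rw [this]
    exact .refl _
  | succ r ih =>
    rw [chainCnt_succ]
    exact (ih fun i hi => h i (by omega)).append (.single (h r (by omega)))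

/-- Under (c4), every class occurs exactly once between `x ∈ P` and `τ⁻¹x`. -/
theorem CondC4.chainCount_one {L : Type*} [PartialOrder L] {t : L → L} (hc4 : CondC4 t) {x : L}
    (hx : x ∈ TauP t) {p : L × L} (hp : p.2 ⋖ p.1) : ChainCount t p x (t x) 1 := by
  obtain ⟨r, w, h0, hr, hw, hdist, hall⟩ := hc4 x hx
  obtain ⟨i, hi, hip⟩ := hall p hp
  have h1 : chainCnt t w r p = 1 := by
    rw [chainCnt, Set.ncard_eq_one]
    refine ⟨i, Set.eq_singleton_iff_unique_mem.2 ⟨⟨hi, hip⟩, fun j hj => ?_⟩⟩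
    by_contra hne
    exact hdist j hj.1 i hi hne (.trans _ _ _ hj.2 (.symm _ _ hip))
  have := hw.chainCount (t := t) p
  rwa [h1, h0, hr] at this

/-- Under (c0)–(c2), principal filters are finite. -/
theorem TauMap.finite_Ici {L : Type*} [Lattice L] {t : L → L} (ht : TauMap t) (hc0 : CondC0 t)
    (hc1 : CondC1 t) (hc2 : CondC2 t) (x : L) : (Set.Ici x).Finite := by
  obtain ⟨⟨r, q⟩, ⟨hq, rfl⟩, -⟩ := hc1 x
  have le_iff : ∀ (n : ℕ) (a b : L), a ≤ b ↔ t^[n] a ≤ t^[n] b := by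
    intro n
    induction n with
    | zero => simp
    | succ n ih => intro a b; simp only [Function.iterate_succ_apply', ← ht.le_iff, ih a b]
  refine Set.Finite.subset
    (((Set.finite_Iic r).prod hc0.2).image fun s : ℕ × L => t^[s.1] s.2) fun y hy => ?_
  obtain ⟨⟨k, v⟩, ⟨hv, rfl⟩, -⟩ := hc1 y
  refine ⟨(k, v), ⟨?_, hv⟩, rfl⟩
  by_contra hk
  obtain ⟨d, rfl⟩ := Nat.exists_eq_add_of_lt (not_le.1 hk)
  have hle : q ≤ t^[d + 1] v := by
    rw [le_iff r, ← Function.iterate_add_apply, ← add_assoc]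
    exact hy
  rcases hle.lt_or_eq with hlt | heq
  · exact hc2 q hq v hv (d + 1) d.succ_pos hlt
  · exact hq ⟨t^[d] v, by rw [heq, Function.iterate_succ_apply']⟩

section DistribLattice

variable {L : Type*} [DistribLattice L] {t : L → L} {p : L × L} {x y z u v : L} {n m : ℕ}

/-- Meeting with `v'` moves the covering pair `(u, v)` one step down in its class. -/
theorem CovBy.inf_of_ne {v' : L} (h : v ⋖ u) (h' : v' ⋖ u) (hne : v ≠ v') :
    v ⊓ v' ⋖ v' ∧ CPeq t (u, v) (v', v ⊓ v') := by
  have hu : v ⊔ v' = u := h.wcovBy.sup_eq h'.wcovBy hne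
  have h₁ : v ⊓ v' ⋖ v' := inf_covBy_of_covBy_sup_left (hu.symm ▸ h)
  have h₂ : v ⊓ v' ⋖ v := inf_covBy_of_covBy_sup_right (hu.symm ▸ h')
  exact ⟨h₁, .rel _ _ (.inr ⟨h, h₁, h', h₂⟩)⟩

namespace ChainCount

theorem inf_covBy_and_cpeq {d : L} (c : ChainCount t p u d n) (h : v ⋖ u) (hu : u ≤ v ⊔ d) :
    v ⊓ d ⋖ d ∧ CPeq t (u, v) (d, v ⊓ d) := by
  induction c generalizing v with
  | refl u =>
    rw [inf_eq_left.2 h.le]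
    exact ⟨h, .refl _⟩
  | @step u u' d n hc c ih =>
    have hne : v ≠ u' := by
      rintro rfl
      exact h.lt.not_ge (hu.trans (sup_le le_rfl c.le))
    obtain ⟨h₁, e₁⟩ := h.inf_of_ne (t := t) hc hne
    have hle : u' ≤ (v ⊓ u') ⊔ d := by
      rw [sup_inf_right, sup_eq_left.2 c.le]
      exact le_inf (hc.le.trans hu) le_rfl
    have := ih h₁ hle
    rw [inf_assoc, inf_eq_right.2 c.le] at this
    exact ⟨this.1, .trans _ _ _ e₁ this.2⟩

/-- If lower covers of any element are pairwise inequivalent, then a class met in the first step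
of one chain from `u` is not met by a chain from `u` to an element joining back to `u`. -/
theorem eq_zero_of_cpeq
    (hloc : ∀ u v v' : L, v ⋖ u → v' ⋖ u → v ≠ v' → CPeq t (u, v) p → ¬ CPeq t (u, v') p)
    (c : ChainCount t p u y m) (h : v ⋖ u) (hu : u ≤ v ⊔ y) (hv : CPeq t (u, v) p) : m = 0 := by
  induction c generalizing v with
  | refl => rfl
  | @step u u' y m hc c ih =>
    have hne : v ≠ u' := by
      rintro rfl
      exact h.lt.not_ge (hu.trans (sup_le le_rfl c.le))
    obtain ⟨h₁, e₁⟩ := h.inf_of_ne (t := t) hc hne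
    have hle : u' ≤ (v ⊓ u') ⊔ y := by
      rw [sup_inf_right, sup_eq_left.2 c.le]
      exact le_inf (hc.le.trans hu) le_rfl
    rw [pairWeight_eq_zero (hloc u v u' h hc hne hv), ih h₁ hle (e₁.congr_left.1 hv)]

variable [LocallyFiniteOrder L]

/-- Chains are transported along perspectivities. -/
theorem inf_right (c : ChainCount t p u x n) (hu : u ≤ x ⊔ y) :
    ChainCount t p (u ⊓ y) (x ⊓ y) n := by
  induction c with
  | refl => exact .refl _
  | @step u v x n hc c ih =>
    have hle : u ≤ v ⊔ (u ⊓ y) := by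
      rw [sup_inf_left, sup_eq_right.2 hc.le]
      exact le_inf le_rfl (hu.trans (sup_le_sup_right c.le _))
    obtain ⟨k, hk⟩ := exists_of_le (t := t) (p := p) (inf_le_left : u ⊓ y ≤ u)
    have := hk.inf_covBy_and_cpeq hc hle
    rw [← inf_assoc, inf_eq_left.2 hc.le] at this
    rw [pairWeight_congr this.2]
    exact .step this.1 (ih (hc.le.trans hu))

/-- The Jordan–Hölder property. -/
theorem unique (c : ChainCount t p x z n) (c' : ChainCount t p x z m) : n = m := by
  induction hk : (Finset.Icc z x).card using Nat.strong_induction_on generalizing x n m with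
  | _ k ih =>
    subst hk
    have lt_of : ∀ {a : L}, a ⋖ x → z ≤ a → (Finset.Icc z a).card < (Finset.Icc z x).card :=
      fun ha hz => Finset.card_lt_card (Finset.Icc_ssubset_Icc_right (hz.trans ha.le) le_rfl ha.lt)
    cases c with
    | refl =>
      cases c' with
      | refl => rfl
      | step hb cb => exact absurd cb.le hb.lt.not_ge
    | @step _ a _ n ha ca =>
      cases c' with
      | refl => exact absurd ca.le ha.lt.not_ge
      | @step _ b _ m hb cb =>
        rcases eq_or_ne a b with rfl | hne
        · rw [ih _ (lt_of ha ca.le) ca cb rfl]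
        · obtain ⟨h₁, e₁⟩ := ha.inf_of_ne (t := t) hb hne
          obtain ⟨h₂, e₂⟩ := hb.inf_of_ne (t := t) ha hne.symm
          rw [inf_comm] at h₂ e₂
          obtain ⟨k, hk⟩ := exists_of_le (t := t) (p := p) (le_inf ca.le cb.le)
          rw [ih _ (lt_of ha ca.le) ca (.step h₂ hk) rfl,
            ih _ (lt_of hb cb.le) cb (.step h₁ hk) rfl, pairWeight_congr e₁, pairWeight_congr e₂]
          omega

theorem phi_eq [OrderTop L] (c : ChainCount t p ⊤ x n) : phi t x p = n := by
  have h := c.exists_isCovChain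
  rw [phi, dif_pos h]
  have key : ∀ (w : ℕ → L) (r : ℕ), w 0 = ⊤ ∧ w r = x ∧ IsCovChain w r →
      chainCnt t w r p = n := by
    rintro w r ⟨h0, hr, hw⟩
    have := hw.chainCount (t := t) p
    rw [h0, hr] at this
    exact this.unique c
  exact key _ _ h.choose_spec.choose_spec

theorem eq_zero_or_eq_zero
    (hloc : ∀ u v v' : L, v ⋖ u → v' ⋖ u → v ≠ v' → CPeq t (u, v) p → ¬ CPeq t (u, v') p)
    (c : ChainCount t p u x n) (c' : ChainCount t p u y m) (hu : u ≤ x ⊔ y) :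
    n = 0 ∨ m = 0 := by
  induction c generalizing y with
  | refl => exact .inl rfl
  | @step u v x n hc c ih =>
    by_cases hv : CPeq t (u, v) p
    · exact .inr (c'.eq_zero_of_cpeq hloc hc (hu.trans (sup_le_sup_right c.le _)) hv)
    · have c₁ := c'.inf_right (y := v) (by
        rw [sup_comm]; exact hu.trans (sup_le_sup_right c.le _))
      rw [inf_eq_right.2 hc.le] at c₁
      rw [pairWeight_eq_zero hv, zero_add]
      refine ih c₁ ?_
      rw [sup_inf_left, sup_eq_right.2 c.le]
      exact le_inf (hc.le.trans hu) le_rfl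

end ChainCount

/-- Distinct lower covers of an element give inequivalent covering pairs. -/
theorem CondC4.not_cpeq_of_ne [LocallyFiniteOrder L] (ht : TauMap t) (hc1 : CondC1 t)
    (hc3 : CondC3 t) (hc4 : CondC4 t) (hp : p.2 ⋖ p.1) {v' : L} (h : v ⋖ u) (h' : v' ⋖ u)
    (hne : v ≠ v') (hv : CPeq t (u, v) p) : ¬ CPeq t (u, v') p := by
  intro hv'
  have hone : ChainCount t p u (t u) 1 := by
    obtain ⟨⟨r, q⟩, ⟨hq, rfl⟩, -⟩ := hc1 u
    have := (hc4.chainCount_one hq hp).map_iterate ht.cov r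
    rwa [← Function.iterate_succ_apply, Function.iterate_succ_apply'] at this
  obtain ⟨h₁, e₁⟩ := h.inf_of_ne (t := t) h' hne
  obtain ⟨k, hk⟩ := ChainCount.exists_of_le (t := t) (p := p) (le_inf (hc3 _ _ h) (hc3 _ _ h'))
  have := hone.unique (.step h' (.step h₁ hk))
  rw [pairWeight_eq_one hv', pairWeight_eq_one (e₁.congr_left.1 hv)] at this
  omega

end DistribLattice

/-- If `(L, τ⁻¹)` satisfies (c0)–(c4), then for all `x, y ∈ L` and every
`λ ∈ Λ` (represented by a covering pair `p`), `φ(x ⊔ y)_λ = min (φ(x)_λ) (φ(y)_λ)` and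
`φ(x ⊓ y)_λ = max (φ(x)_λ) (φ(y)_λ)`. -/
theorem stmt10 {L : Type*} [DistribLattice L] [OrderTop L] [Infinite L] (t : L → L)
    (ht : TauMap t) (hc0 : CondC0 t) (hc1 : CondC1 t) (hc2 : CondC2 t) (hc3 : CondC3 t)
    (hc4 : CondC4 t) :
    ∀ x y : L, ∀ p : L × L, p.2 ⋖ p.1 →
      phi t (x ⊔ y) p = min (phi t x p) (phi t y p) ∧
      phi t (x ⊓ y) p = max (phi t x p) (phi t y p) := by
  intro x y p hp
  let _ : LocallyFiniteOrder L := LocallyFiniteOrder.ofFiniteIcc fun a b =>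
    (ht.finite_Ici hc0 hc1 hc2 a).subset Set.Icc_subset_Ici_self
  obtain ⟨a, ha⟩ := ChainCount.exists_of_le (t := t) (p := p) (le_top : x ⊔ y ≤ ⊤)
  obtain ⟨n, hn⟩ := ChainCount.exists_of_le (t := t) (p := p) (le_sup_left : x ≤ x ⊔ y)
  obtain ⟨m, hm⟩ := ChainCount.exists_of_le (t := t) (p := p) (le_sup_right : y ≤ x ⊔ y)
  have hx := ha.append hn
  have hinf := hm.inf_right (y := x) (by rw [sup_comm])
  rw [inf_eq_right.2 (le_sup_left : x ≤ x ⊔ y), inf_comm] at hinf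
  have h0 := hn.eq_zero_or_eq_zero
    (fun _ _ _ h h' => hc4.not_cpeq_of_ne ht hc1 hc3 hp h h') hm le_rfl
  rw [ha.phi_eq, hx.phi_eq, (ha.append hm).phi_eq, (hx.append hinf).phi_eq]
  omega
end
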